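/- Let T be a Calderón–Zygmund operator with normalised standard kernel of Hölder exponent γ. There is C depending only on n, γ such that for all I, J ∈ 𝒟 with ℓ(I) ≤ ℓ(J), all m ∈ ℤⁿ∖{0}, all η ∈ {0,1}ⁿ∖{0}, and all λ > 0: (1/|J|) |{ x ∈ J : | |J|^{1/2} Σ_{K⊆J, ℓ(K)=ℓ(I)} ⟨h⁰_{J∔m}, T h^η_K⟩ h^η_K(x) | > λ }| is at most 1_{[0, C (ℓ(I)/ℓ(J))^γ (1+|m|)^{−n−γ}]}(λ) when m ∉ {−1,0,1}ⁿ, and at most C · min{λ^{−1/γ} ℓ(I)/ℓ(J), 1} · 1_{[0,C]}(λ) when m ∈ {−1,0,1}ⁿ∖{0}. -/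

import Mathlib

open MeasureTheory

noncomputable section

open Classical in
/-- Classical indicator of a proposition. -/
def indR (P : Prop) : ℝ := if P then 1 else 0

/-- The real sign associated to a boolean. -/
def sgnB (b : Bool) : ℝ := if b then 1 else -1

/-- The `ℓ∞` norm of an integer vector, as a real number. -/
def inorm {n : ℕ} (m : Fin n → ℤ) : ℝ := ‖(fun i => (m i : ℝ) : Fin n → ℝ)‖

/-- The dyadic cube `2^{-k}([0,1)^n + m)` of generation `k` in `ℝ^n` (with the `ℓ∞` metric). -/
def dyadicCube (n : ℕ) (k : ℤ) (m : Fin n → ℤ) : Set (Fin n → ℝ) :=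
  {x | ∀ i, (2:ℝ) ^ (-k) * m i ≤ x i ∧ x i < (2:ℝ) ^ (-k) * (m i + 1)}

/-- The side length `2^{-k}` of a dyadic cube of generation `k`. -/
def sideLen (k : ℤ) : ℝ := (2:ℝ) ^ (-k)

/-- One-dimensional Haar function on the dyadic interval `2^{-k}[m, m+1)`:
the non-cancellative `h⁰` for `η = false`, the cancellative `h¹` for `η = true`. -/
def haar1D (k : ℤ) (m : ℤ) (η : Bool) (t : ℝ) : ℝ :=
  (Real.sqrt ((2:ℝ) ^ (-k)))⁻¹ *
    (if η then
        (Set.Ico ((2:ℝ) ^ (-k) * m) ((2:ℝ) ^ (-k) * (m + 1/2))).indicator 1 t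
          - (Set.Ico ((2:ℝ) ^ (-k) * (m + 1/2)) ((2:ℝ) ^ (-k) * (m + 1))).indicator 1 t
      else (Set.Ico ((2:ℝ) ^ (-k) * m) ((2:ℝ) ^ (-k) * (m + 1))).indicator 1 t)

/-- The Haar function `h^η_I` for the dyadic cube `I` indexed by `(k, m)`. -/
def haarFn (n : ℕ) (k : ℤ) (m : Fin n → ℤ) (η : Fin n → Bool) (x : Fin n → ℝ) : ℝ :=
  ∏ i, haar1D k (m i) (η i) (x i)

/-- The non-cancellative Haar function `h⁰_I = |I|^{-1/2} 1_I`. -/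
def haarZero (n : ℕ) (k : ℤ) (m : Fin n → ℤ) : (Fin n → ℝ) → ℝ :=
  haarFn n k m (fun _ => false)

/-- The pairing `⟨g, f⟩ = ∫ g f dx`. -/
def pairing {n : ℕ} (g f : (Fin n → ℝ) → ℝ) : ℝ := ∫ x, g x * f x

/-- A normalised standard kernel with Hölder exponent `γ` (with respect to the `ℓ∞` metric). -/
structure IsNormalisedKernel (n : ℕ) (γ : ℝ) (K : (Fin n → ℝ) → (Fin n → ℝ) → ℝ) : Prop where
  size : ∀ x y, x ≠ y → |K x y| ≤ dist x y ^ (-(n:ℝ))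
  smooth : ∀ x y h, 2 * ‖h‖ < dist x y →
    |K (x + h) y - K x y| + |K x (y + h) - K x y| ≤ ‖h‖ ^ γ * dist x y ^ (-(n:ℝ) - γ)

/-- The singular integral `Tf(x) = ∫ K(x,y) f(y) dy`. -/
def czIntegral {n : ℕ} (K : (Fin n → ℝ) → (Fin n → ℝ) → ℝ) (f : (Fin n → ℝ) → ℝ)
    (x : Fin n → ℝ) : ℝ := ∫ y, K x y * f y

/-- The truncated singular integral `T_ε f(x) = ∫_{|y-x|>ε} K(x,y) f(y) dy`. -/
def czTrunc {n : ℕ} (K : (Fin n → ℝ) → (Fin n → ℝ) → ℝ) (ε : ℝ) (f : (Fin n → ℝ) → ℝ)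
    (x : Fin n → ℝ) : ℝ := ∫ y in {y | ε < dist x y}, K x y * f y

/-- The dyadic conditional expectation `E_k f`. -/
def dyadicE (n : ℕ) (k : ℤ) (f : (Fin n → ℝ) → ℝ) (x : Fin n → ℝ) : ℝ :=
  (2:ℝ) ^ (k * (n:ℤ)) * ∫ y in dyadicCube n k (fun i => ⌊(2:ℝ) ^ k * x i⌋), f y

/-- The dyadic martingale difference `D_k f = E_{k+1} f - E_k f`. -/
def dyadicD (n : ℕ) (k : ℤ) (f : (Fin n → ℝ) → ℝ) (x : Fin n → ℝ) : ℝ :=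
  dyadicE n (k+1) f x - dyadicE n k f x

/-- The centre of the dyadic cube indexed by `(k, m)`. -/
def cubeCenter (n : ℕ) (k : ℤ) (m : Fin n → ℤ) : Fin n → ℝ :=
  fun i => (2:ℝ) ^ (-k) * (m i + 1/2)

/-- The concentric `c`-fold expansion of the dyadic cube indexed by `(k, m)`. -/
def expandCube (n : ℕ) (k : ℤ) (m : Fin n → ℤ) (c : ℝ) : Set (Fin n → ℝ) :=
  {x | ∀ i, |x i - cubeCenter n k m i| ≤ c * (2:ℝ) ^ (-k) / 2}

/-- The set `Σ_{f,s} = ⋃_k 9Ω_k`, where `Ω_k` is the union of the cubes `I ∈ 𝒟_k` on which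
`D_{k+s} f` is not a.e. zero. -/
def SigmaSet (n : ℕ) (f : (Fin n → ℝ) → ℝ) (s : ℕ) : Set (Fin n → ℝ) :=
  ⋃ (k : ℤ) (m : Fin n → ℤ)
    (_ : ¬ (∀ᵐ x ∂(volume.restrict (dyadicCube n k m)), dyadicD n (k + (s:ℤ)) f x = 0)),
      expandCube n k m 9

/-- The (measure-theoretic) support of a measurable function: the complement of the union of
all balls on which the function vanishes a.e. -/
def suppAE {n : ℕ} (f : (Fin n → ℝ) → ℝ) : Set (Fin n → ℝ) :=
  {x | ∀ r > 0, ¬ (∀ᵐ y ∂(volume.restrict (Metric.ball x r)), f y = 0)}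

/-- The axis-parallel closed cube with centre `c` and side length `ρ`. -/
def cube (n : ℕ) (c : Fin n → ℝ) (ρ : ℝ) : Set (Fin n → ℝ) :=
  {x | ∀ i, |x i - c i| ≤ ρ / 2}

/-- The index of the `s`-th dyadic ancestor `I^{(s)}` of the cube indexed by `(k, m)`
(the ancestor is the cube indexed by `(k - s, ancestorIdx s m)`). -/
def ancestorIdx {n : ℕ} (s : ℕ) (m : Fin n → ℤ) : Fin n → ℤ :=
  fun i => Int.fdiv (m i) (2 ^ s)

/-- The distance between two sets (in the ambient metric). -/
def setDist {α : Type*} [PseudoMetricSpace α] (A B : Set α) : ℝ :=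
  sInf (Set.image2 dist A B)

/-- The lower integral of a power tail outside a ball scales like a power of the radius. -/
theorem exists_lintegral_dist_tail_le (n : ℕ) {α : ℝ} (hα : 0 < α) :
    ∃ B : ℝ, 0 < B ∧ ∀ s : ℝ, 0 < s → ∀ c : Fin n → ℝ,
      ∫⁻ z in {z : Fin n → ℝ | s ≤ dist z c}, ENNReal.ofReal (dist z c ^ (-(n:ℝ) - α)) ≤
        ENNReal.ofReal (B * s ^ (-α)) := by
  set D := ∫⁻ z : Fin n → ℝ, ENNReal.ofReal ((1 + ‖z‖) ^ (-((n:ℝ) + α))) with hD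
  have hfin : D < ⊤ := by
    apply finite_integral_one_add_norm
    simp [hα]
  refine ⟨2 ^ ((n:ℝ) + α) * (D.toReal + 1), by positivity, fun s hs c => ?_⟩
  have hmeas : MeasurableSet {z : Fin n → ℝ | s ≤ dist z c} :=
    measurableSet_le measurable_const (by fun_prop)
  have hpt : ∀ z ∈ {z : Fin n → ℝ | s ≤ dist z c},
      ENNReal.ofReal (dist z c ^ (-(n:ℝ) - α)) ≤
        ENNReal.ofReal (2 ^ ((n:ℝ) + α) * s ^ (-((n:ℝ) + α))) *
          ENNReal.ofReal ((1 + ‖s⁻¹ • (z - c)‖) ^ (-((n:ℝ) + α))) := by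
    intro z hz
    have hz' : s ≤ ‖z - c‖ := by simpa [dist_eq_norm] using hz
    rw [← ENNReal.ofReal_mul (by positivity)]
    apply ENNReal.ofReal_le_ofReal
    rw [norm_smul, norm_inv, Real.norm_of_nonneg hs.le, dist_eq_norm, sub_eq_add_neg (-(n:ℝ)) α,
      ← neg_add, Real.rpow_neg (by positivity), Real.rpow_neg (by positivity),
      Real.rpow_neg (by positivity)]
    have h1 : (2:ℝ) ^ ((n:ℝ) + α) * (s ^ ((n:ℝ) + α))⁻¹ *
        ((1 + s⁻¹ * ‖z - c‖) ^ ((n:ℝ) + α))⁻¹ =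
        (((s * (1 + s⁻¹ * ‖z - c‖)) / 2) ^ ((n:ℝ) + α))⁻¹ := by
      rw [Real.div_rpow (by positivity) (by positivity), Real.mul_rpow hs.le (by positivity)]
      field_simp
    rw [h1]
    have hpos : 0 < ‖z - c‖ := hs.trans_le hz'
    have h2 : s * (1 + s⁻¹ * ‖z - c‖) / 2 ≤ ‖z - c‖ := by
      have : s * (1 + s⁻¹ * ‖z - c‖) = s + ‖z - c‖ := by field_simp
      rw [this]; linarith
    gcongr
  have hscale : ∫⁻ z : Fin n → ℝ, ENNReal.ofReal ((1 + ‖s⁻¹ • (z - c)‖) ^ (-((n:ℝ) + α))) =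
      ENNReal.ofReal (s ^ n) * D := by
    rw [lintegral_sub_right_eq_self
      (fun z : Fin n → ℝ => ENNReal.ofReal ((1 + ‖s⁻¹ • z‖) ^ (-((n:ℝ) + α)))) c]
    have h1 := Measure.map_addHaar_smul (volume : Measure (Fin n → ℝ)) (inv_ne_zero hs.ne')
    have h2 := lintegral_map (μ := (volume : Measure (Fin n → ℝ)))
      (f := fun z : Fin n → ℝ => ENNReal.ofReal ((1 + ‖z‖) ^ (-((n:ℝ) + α))))
      (g := fun z => s⁻¹ • z) (by fun_prop) (by fun_prop)
    rw [← h2, h1, lintegral_smul_measure, ← hD]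
    simp [abs_of_pos hs]
  calc _ ≤ ∫⁻ z in {z : Fin n → ℝ | s ≤ dist z c},
        ENNReal.ofReal (2 ^ ((n:ℝ) + α) * s ^ (-((n:ℝ) + α))) *
          ENNReal.ofReal ((1 + ‖s⁻¹ • (z - c)‖) ^ (-((n:ℝ) + α))) := setLIntegral_mono' hmeas hpt
    _ ≤ ∫⁻ z, ENNReal.ofReal (2 ^ ((n:ℝ) + α) * s ^ (-((n:ℝ) + α))) *
          ENNReal.ofReal ((1 + ‖s⁻¹ • (z - c)‖) ^ (-((n:ℝ) + α))) := setLIntegral_le_lintegral _ _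
    _ = ENNReal.ofReal (2 ^ ((n:ℝ) + α) * s ^ (-((n:ℝ) + α))) * (ENNReal.ofReal (s ^ n) * D) := by
      rw [lintegral_const_mul' _ _ ENNReal.ofReal_ne_top, hscale]
    _ ≤ _ := by
      rw [← ENNReal.ofReal_toReal hfin.ne, ← ENNReal.ofReal_mul (by positivity),
        ← ENNReal.ofReal_mul (by positivity)]
      apply ENNReal.ofReal_le_ofReal
      have h3 : s ^ (-((n:ℝ) + α)) * s ^ n = s ^ (-α) := by
        rw [← Real.rpow_natCast, ← Real.rpow_add hs]; congr 1; ring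
      rw [ENNReal.toReal_ofReal ENNReal.toReal_nonneg]
      calc _ = 2 ^ ((n:ℝ) + α) * D.toReal * (s ^ (-((n:ℝ) + α)) * s ^ n) := by ring
        _ ≤ _ := by
          rw [h3]; gcongr; linarith

/-- The lower integral over a cube of the inverse square root of the distance to a hyperplane. -/
theorem lintegral_rpow_neg_half_le (n : ℕ) (i : Fin n) (c : Fin n → ℝ) (p : ℝ) {l : ℝ}
    (hl : 0 < l) :
    ∫⁻ x in {x : Fin n → ℝ | dist x c ≤ l ∧ |x i - p| ≤ l},
        ENNReal.ofReal (|x i - p| ^ (-(1/2):ℝ)) ≤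
      ENNReal.ofReal (2 ^ (n+1) * l ^ n * l ^ (-(1/2):ℝ)) := by
  let f : ℝ → ℝ := (Set.Ioc 0 l).indicator fun v => v ^ (-(1/2):ℝ)
  have hfint : ∫ v in Set.Ioi 0, f v = 2 * l ^ (1/2:ℝ) := by
    rw [setIntegral_indicator measurableSet_Ioc, Set.inter_eq_self_of_subset_right
      Set.Ioc_subset_Ioi_self, ← intervalIntegral.integral_of_le hl.le,
      integral_rpow (Or.inl (by norm_num))]
    norm_num
    ring
  let F : Fin n → ℝ → ℝ := fun j u =>
    if j = i then f |u - p| else (Set.Icc (c j - l) (c j + l)).indicator 1 u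
  have hFint : ∀ j, Integrable (F j) := by
    intro j
    by_cases hj : j = i
    · simp only [F, hj, if_true]
      have hne : ∫ u, f |u| ≠ 0 := by
        rw [integral_comp_abs, hfint]
        positivity
      exact (Integrable.of_integral_ne_zero hne).comp_sub_right p
    · simp only [F, hj, if_false]
      exact (integrable_indicator_iff measurableSet_Icc).2
        (integrableOn_const (C := (1:ℝ)) measure_Icc_lt_top.ne)
  have hFval : ∀ j, ∫ u, F j u = if j = i then 4 * l ^ (1/2:ℝ) else 2 * l := by
    intro j
    by_cases hj : j = i
    · simp only [F, hj, if_true]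
      rw [integral_sub_right_eq_self (fun u => f |u|) p, integral_comp_abs, hfint]
      ring
    · simp only [F, hj, if_false]
      rw [integral_indicator_one measurableSet_Icc]
      simp [Measure.real]
      rw [ENNReal.toReal_ofReal (by linarith)]; ring
  have hF0 : ∀ j u, 0 ≤ F j u := by
    intro j u
    by_cases hj : j = i
    · simp only [F, hj, if_true, f]
      exact Set.indicator_nonneg (fun v hv => Real.rpow_nonneg hv.1.le _) _
    · simp only [F, hj, if_false]
      exact Set.indicator_nonneg (fun v hv => by simp) _
  have hmeas : MeasurableSet {x : Fin n → ℝ | dist x c ≤ l ∧ |x i - p| ≤ l} :=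
    (measurableSet_le (f := fun x => dist x c) (by fun_prop) measurable_const).inter
      (measurableSet_le (f := fun x : Fin n → ℝ => ‖x i - p‖) (by fun_prop) measurable_const)
  have hpt : ∀ᵐ x : Fin n → ℝ, x ∈ {x : Fin n → ℝ | dist x c ≤ l ∧ |x i - p| ≤ l} →
      ENNReal.ofReal (|x i - p| ^ (-(1/2):ℝ)) ≤ ENNReal.ofReal (∏ j, F j (x j)) := by
    have hne : ∀ᵐ x : Fin n → ℝ, x i ≠ p := Measure.ae_eval_ne (fun _ => (volume : Measure ℝ)) i p
    filter_upwards [hne] with x hx hxm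
    apply ENNReal.ofReal_le_ofReal
    have : ∏ j, F j (x j) = ∏ j, if j = i then |x i - p| ^ (-(1/2):ℝ) else 1 := by
      apply Finset.prod_congr rfl
      intro j _
      by_cases hj : j = i
      · subst hj
        simp only [F, if_true, f]
        exact Set.indicator_of_mem
          (show |x j - p| ∈ Set.Ioc 0 l from ⟨abs_pos.2 (sub_ne_zero.2 hx), hxm.2⟩) _
      · simp only [F, hj, if_false]
        rw [Set.indicator_of_mem]
        · rfl
        · have := (dist_le_pi_dist x c j).trans hxm.1
          rw [Real.dist_eq, abs_le] at this
          constructor <;> linarith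
    rw [this]; simp
  calc _ ≤ ∫⁻ x in {x : Fin n → ℝ | dist x c ≤ l ∧ |x i - p| ≤ l},
          ENNReal.ofReal (∏ j, F j (x j)) := setLIntegral_mono_ae' hmeas hpt
    _ ≤ ∫⁻ x : Fin n → ℝ, ENNReal.ofReal (∏ j, F j (x j)) := setLIntegral_le_lintegral _ _
    _ = ENNReal.ofReal (∫ x : Fin n → ℝ, ∏ j, F j (x j)) :=
      (ofReal_integral_eq_lintegral_ofReal (Integrable.fintype_prod hFint)
        (Filter.Eventually.of_forall fun x => Finset.prod_nonneg fun j _ => hF0 _ _)).symm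
    _ ≤ _ := by
      rw [integral_fintype_prod_volume_eq_prod]
      apply ENNReal.ofReal_le_ofReal
      have : ∀ j, ∫ u, F j u = (2 * l) * if j = i then 2 * l ^ (-(1/2):ℝ) else 1 := by
        intro j
        rw [hFval]
        split_ifs
        · have : l ^ (1/2:ℝ) = l * l ^ (-(1/2):ℝ) := by
            rw [← Real.rpow_one_add' hl.le (by norm_num)]; norm_num
          rw [this]; ring
        · ring
      simp only [this, Finset.prod_mul_distrib]
      simp
      apply le_of_eq
      ring

theorem dyadicCube_eq_pi (n : ℕ) (k : ℤ) (q : Fin n → ℤ) :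
    dyadicCube n k q =
      Set.univ.pi fun i => Set.Ico ((2:ℝ) ^ (-k) * q i) ((2:ℝ) ^ (-k) * (q i + 1)) := by
  ext x
  simp [dyadicCube, Set.mem_pi]

theorem measurableSet_dyadicCube (n : ℕ) (k : ℤ) (q : Fin n → ℤ) :
    MeasurableSet (dyadicCube n k q) := by
  rw [dyadicCube_eq_pi]
  exact MeasurableSet.univ_pi fun _ => measurableSet_Ico

theorem volume_dyadicCube (n : ℕ) (k : ℤ) (q : Fin n → ℤ) :
    volume (dyadicCube n k q) = ENNReal.ofReal (((2:ℝ) ^ (-k)) ^ n) := by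
  rw [dyadicCube_eq_pi, Real.volume_pi_Ico]
  have : ∀ i, (2:ℝ) ^ (-k) * (q i + 1) - (2:ℝ) ^ (-k) * q i = (2:ℝ) ^ (-k) := fun i => by ring
  simp only [this, Finset.prod_const, Finset.card_univ, Fintype.card_fin]
  rw [ENNReal.ofReal_pow (by positivity)]

/-- The part of a dyadic cube close to a hyperplane orthogonal to a coordinate axis. -/
theorem volume_dyadicCube_inter_strip_le (n : ℕ) (k : ℤ) (q : Fin n → ℤ) (i : Fin n) (p : ℝ)
    {t : ℝ} (ht : 0 ≤ t) :
    volume {x ∈ dyadicCube n k q | |x i - p| ≤ t} ≤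
      ENNReal.ofReal (2 * t / (2:ℝ) ^ (-k) * ((2:ℝ) ^ (-k)) ^ n) := by
  set L := (2:ℝ) ^ (-k) with hL
  have hLpos : 0 < L := by positivity
  let a : Fin n → ℝ := fun j => if j = i then p - t else L * q j
  let b : Fin n → ℝ := fun j => if j = i then p + t else L * (q j + 1)
  have hsub : {x ∈ dyadicCube n k q | |x i - p| ≤ t} ⊆ Set.Icc a b := by
    rintro x ⟨hx, hxt⟩
    rw [abs_le] at hxt
    constructor <;> intro j <;> by_cases hj : j = i
    · subst hj; simp [a]; linarith
    · simp only [a, hj, if_false]; exact (hx j).1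
    · subst hj; simp [b]; linarith
    · simp only [b, hj, if_false]; exact (hx j).2.le
  refine (measure_mono hsub).trans ?_
  rw [Real.volume_Icc_pi, ← ENNReal.ofReal_prod_of_nonneg]
  · apply ENNReal.ofReal_le_ofReal
    have : ∀ j, b j - a j = L * if j = i then 2 * t / L else 1 := by
      intro j
      simp only [a, b]
      split_ifs
      · field_simp; ring
      · ring
    simp only [this, Finset.prod_mul_distrib]
    simp
    apply le_of_eq
    ring
  · intro j _
    simp only [a, b]
    split_ifs
    · linarith
    · nlinarith

theorem abs_haar1D (k q : ℤ) (e : Bool) (t : ℝ) :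
    |haar1D k q e t| = (Set.Ico ((2:ℝ) ^ (-k) * q) ((2:ℝ) ^ (-k) * (q + 1))).indicator
      (fun _ => (Real.sqrt ((2:ℝ) ^ (-k)))⁻¹) t := by
  have hL : (0:ℝ) < (2:ℝ) ^ (-k) := by positivity
  unfold haar1D
  rw [abs_mul, abs_of_nonneg (by positivity)]
  generalize (2:ℝ) ^ (-k) = L at *
  have h1 : L * q < L * (q + 1/2) := by nlinarith
  have h2 : L * ((q:ℝ) + 1/2) < L * (q + 1) := by nlinarith
  cases e
  · by_cases h : t ∈ Set.Ico (L * q) (L * (q + 1)) <;> simp [h]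
  · simp only [if_true]
    by_cases hlo : L * q ≤ t
    · by_cases hhi : t < L * (q + 1)
      · rw [Set.indicator_of_mem (show t ∈ Set.Ico (L * q) (L * (q + 1)) from ⟨hlo, hhi⟩)]
        by_cases hmid : t < L * (q + 1/2)
        · rw [Set.indicator_of_mem (show t ∈ Set.Ico (L * q) (L * (q + 1/2)) from ⟨hlo, hmid⟩),
            Set.indicator_of_notMem (fun h => absurd h.1 (not_le.2 hmid))]
          simp
        · rw [Set.indicator_of_notMem (fun h => hmid h.2),
            Set.indicator_of_mem
              (show t ∈ Set.Ico (L * (q + 1/2)) (L * (q + 1)) from ⟨not_lt.1 hmid, hhi⟩)]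
          simp
      · rw [Set.indicator_of_notMem (fun h => hhi (h.2.trans h2)),
          Set.indicator_of_notMem (fun h => hhi h.2), Set.indicator_of_notMem (fun h => hhi h.2)]
        simp
    · rw [Set.indicator_of_notMem (fun h => hlo h.1),
        Set.indicator_of_notMem (fun h => hlo (h1.le.trans h.1)),
        Set.indicator_of_notMem (fun h => hlo h.1)]
      simp

theorem abs_haarFn (n : ℕ) (k : ℤ) (q : Fin n → ℤ) (η : Fin n → Bool) (x : Fin n → ℝ) :
    |haarFn n k q η x| =
      (dyadicCube n k q).indicator (fun _ => (Real.sqrt ((2:ℝ) ^ (-k)))⁻¹ ^ n) x := by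
  unfold haarFn
  rw [Finset.abs_prod]
  simp only [abs_haar1D]
  by_cases hx : x ∈ dyadicCube n k q
  · rw [Set.indicator_of_mem hx, Finset.prod_congr rfl
      (fun i _ => Set.indicator_of_mem (show x i ∈ Set.Ico _ _ from hx i) _)]
    simp
  · rw [Set.indicator_of_notMem hx]
    have : ∃ i, ¬ ((2:ℝ) ^ (-k) * q i ≤ x i ∧ x i < (2:ℝ) ^ (-k) * (q i + 1)) := by
      simpa [dyadicCube] using hx
    obtain ⟨i, hi⟩ := this
    refine Finset.prod_eq_zero (Finset.mem_univ i) (Set.indicator_of_notMem ?_ _)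
    exact hi

theorem integrable_haar1D (k q : ℤ) (e : Bool) : Integrable (haar1D k q e) := by
  have key : ∀ a b : ℝ, Integrable ((Set.Ico a b).indicator (1 : ℝ → ℝ)) := fun a b =>
    (integrable_indicator_iff measurableSet_Ico).2
      (integrableOn_const (C := (1:ℝ)) measure_Ico_lt_top.ne)
  unfold haar1D
  cases e
  · simpa using (key _ _).const_mul _
  · simpa using ((key _ _).sub (key _ _)).const_mul _

theorem integral_haar1D_true (k q : ℤ) : ∫ t, haar1D k q true t = 0 := by
  have hL : (0:ℝ) < (2:ℝ) ^ (-k) := by positivity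
  have key : ∀ a b : ℝ, Integrable ((Set.Ico a b).indicator (1 : ℝ → ℝ)) := fun a b =>
    (integrable_indicator_iff measurableSet_Ico).2
      (integrableOn_const (C := (1:ℝ)) measure_Ico_lt_top.ne)
  simp only [haar1D, if_true]
  rw [integral_const_mul, integral_sub (key _ _) (key _ _),
    integral_indicator_one measurableSet_Ico, integral_indicator_one measurableSet_Ico]
  generalize (2:ℝ) ^ (-k) = L at *
  rw [Real.volume_real_Ico_of_le (by nlinarith), Real.volume_real_Ico_of_le (by nlinarith)]
  ring

theorem integrable_haarFn (n : ℕ) (k : ℤ) (q : Fin n → ℤ) (η : Fin n → Bool) :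
    Integrable (haarFn n k q η) :=
  Integrable.fintype_prod fun i => integrable_haar1D k (q i) (η i)

theorem integral_haarFn_eq_zero (n : ℕ) (k : ℤ) (q : Fin n → ℤ) {η : Fin n → Bool}
    (hη : η ≠ fun _ => false) : ∫ x, haarFn n k q η x = 0 := by
  obtain ⟨i, hi⟩ := Function.ne_iff.1 hη
  unfold haarFn
  rw [integral_fintype_prod_volume_eq_prod (fun i => haar1D k (q i) (η i))]
  refine Finset.prod_eq_zero (Finset.mem_univ i) ?_
  rw [Bool.eq_true_of_not_eq_false hi]
  exact integral_haar1D_true k (q i)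

theorem dist_cubeCenter_le {n : ℕ} {k : ℤ} {q : Fin n → ℤ} {y : Fin n → ℝ}
    (hy : y ∈ dyadicCube n k q) : dist y (cubeCenter n k q) ≤ (2:ℝ) ^ (-k) / 2 := by
  have hL : (0:ℝ) < (2:ℝ) ^ (-k) := by positivity
  refine (dist_pi_le_iff (by positivity)).2 fun i => ?_
  obtain ⟨h1, h2⟩ := hy i
  simp only [cubeCenter]
  rw [Real.dist_eq, abs_le]
  constructor <;> linarith

theorem enorm_haarFn (n : ℕ) (k : ℤ) (q : Fin n → ℤ) (η : Fin n → Bool) (x : Fin n → ℝ) :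
    ‖haarFn n k q η x‖ₑ = (dyadicCube n k q).indicator
      (fun _ => ENNReal.ofReal ((Real.sqrt ((2:ℝ) ^ (-k)))⁻¹ ^ n)) x := by
  rw [← ofReal_norm, Real.norm_eq_abs, abs_haarFn]
  by_cases hx : x ∈ dyadicCube n k q <;> simp [hx]

/-- Any integral against a Haar function is controlled by the lower integral over the cube. -/
theorem lintegral_enorm_mul_haarFn_le (n : ℕ) (k : ℤ) (q : Fin n → ℤ) (η : Fin n → Bool)
    (F : (Fin n → ℝ) → ℝ) :
    ∫⁻ y, ‖F y * haarFn n k q η y‖ₑ ≤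
      ENNReal.ofReal ((Real.sqrt ((2:ℝ) ^ (-k)))⁻¹ ^ n) *
        ∫⁻ y in dyadicCube n k q, ‖F y‖ₑ := by
  rw [← lintegral_const_mul' _ _ ENNReal.ofReal_ne_top,
    ← lintegral_indicator (measurableSet_dyadicCube n k q)]
  refine lintegral_mono fun y => ?_
  rw [enorm_mul, enorm_haarFn]
  by_cases hy : y ∈ dyadicCube n k q
  · simp [hy, mul_comm]
  · simp [hy]

theorem enorm_pairing_haarZero_le (n : ℕ) (k : ℤ) (q : Fin n → ℤ) (F : (Fin n → ℝ) → ℝ) :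
    ‖pairing (haarZero n k q) F‖ₑ ≤
      ENNReal.ofReal ((Real.sqrt ((2:ℝ) ^ (-k)))⁻¹ ^ n) *
        ∫⁻ x in dyadicCube n k q, ‖F x‖ₑ := by
  refine (enorm_integral_le_lintegral_enorm _).trans ?_
  simp only [mul_comm (haarZero n k q _)]
  exact lintegral_enorm_mul_haarFn_le n k q _ F

theorem sqrt_inv_pow_mul_pow {l : ℝ} (hl : 0 < l) (n : ℕ) :
    (Real.sqrt l)⁻¹ ^ n * l ^ n = Real.sqrt l ^ n := by
  rw [← mul_pow]
  congr 1
  field_simp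
  exact (Real.sq_sqrt hl.le).symm

/-- The size estimate for `T h_K`. -/
theorem enorm_czIntegral_haarFn_le_size {n : ℕ} {γ : ℝ} {K : (Fin n → ℝ) → (Fin n → ℝ) → ℝ}
    (hK : IsNormalisedKernel n γ K) (k : ℤ) (q : Fin n → ℤ) (η : Fin n → Bool) {x : Fin n → ℝ}
    (hx : x ∉ dyadicCube n k q) :
    ‖czIntegral K (haarFn n k q η) x‖ₑ ≤
      ENNReal.ofReal ((Real.sqrt ((2:ℝ) ^ (-k)))⁻¹ ^ n) *
        ∫⁻ y in dyadicCube n k q, ENNReal.ofReal (dist x y ^ (-(n:ℝ))) := by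
  refine (enorm_integral_le_lintegral_enorm _).trans
    ((lintegral_enorm_mul_haarFn_le n k q η (K x)).trans ?_)
  refine mul_le_mul_right (setLIntegral_mono' (measurableSet_dyadicCube n k q) fun y hy => ?_) _
  rw [← ofReal_norm]
  exact ENNReal.ofReal_le_ofReal (hK.size x y fun h => hx (h ▸ hy))

/-- The smoothness estimate for `T h_K`, using the cancellation of `h_K`. -/
theorem enorm_czIntegral_haarFn_le_smooth {n : ℕ} {γ : ℝ} (hγ : 0 < γ)
    {K : (Fin n → ℝ) → (Fin n → ℝ) → ℝ}
    (hK : IsNormalisedKernel n γ K) (k : ℤ) (q : Fin n → ℤ) {η : Fin n → Bool}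
    (hη : η ≠ fun _ => false) {x : Fin n → ℝ} (hx : (2:ℝ) ^ (-k) < dist x (cubeCenter n k q)) :
    ‖czIntegral K (haarFn n k q η) x‖ₑ ≤
      ENNReal.ofReal (Real.sqrt ((2:ℝ) ^ (-k)) ^ n * ((2:ℝ) ^ (-k)) ^ γ *
        dist x (cubeCenter n k q) ^ (-(n:ℝ) - γ)) := by
  set c := cubeCenter n k q
  have hl : (0:ℝ) < (2:ℝ) ^ (-k) := by positivity
  have hcancel : ‖czIntegral K (haarFn n k q η) x‖ₑ ≤
      ∫⁻ y, ‖(K x y - K x c) * haarFn n k q η y‖ₑ := by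
    by_cases hI : Integrable fun y => K x y * haarFn n k q η y
    · have h0 : ∫ y, K x c * haarFn n k q η y = 0 := by
        rw [integral_const_mul, integral_haarFn_eq_zero n k q hη, mul_zero]
      have : czIntegral K (haarFn n k q η) x =
          ∫ y, (K x y - K x c) * haarFn n k q η y := by
        simp only [sub_mul]
        rw [integral_sub hI ((integrable_haarFn n k q η).const_mul _), h0, sub_zero]
        rfl
      rw [this]
      exact enorm_integral_le_lintegral_enorm _
    · rw [czIntegral, integral_undef hI]
      simp
  refine hcancel.trans ((lintegral_enorm_mul_haarFn_le n k q η _).trans ?_)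
  have hpt : ∀ y ∈ dyadicCube n k q, ‖K x y - K x c‖ₑ ≤
      ENNReal.ofReal (((2:ℝ) ^ (-k)) ^ γ * dist x c ^ (-(n:ℝ) - γ)) := by
    intro y hy
    have hyc := dist_cubeCenter_le hy
    rw [dist_eq_norm] at hyc
    have hs := hK.smooth x c (y - c) (by linarith)
    rw [add_sub_cancel] at hs
    rw [← ofReal_norm]
    apply ENNReal.ofReal_le_ofReal
    have h1 : ‖y - c‖ ^ γ ≤ ((2:ℝ) ^ (-k)) ^ γ :=
      Real.rpow_le_rpow (norm_nonneg _) (by linarith) hγ.le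
    calc ‖K x y - K x c‖ ≤ ‖y - c‖ ^ γ * dist x c ^ (-(n:ℝ) - γ) :=
          le_trans (le_add_of_nonneg_left (abs_nonneg _)) hs
      _ ≤ _ := by gcongr
  calc _ ≤ ENNReal.ofReal ((Real.sqrt ((2:ℝ) ^ (-k)))⁻¹ ^ n) *
        ∫⁻ y in dyadicCube n k q,
          ENNReal.ofReal (((2:ℝ) ^ (-k)) ^ γ * dist x c ^ (-(n:ℝ) - γ)) :=
        mul_le_mul_right (setLIntegral_mono' (measurableSet_dyadicCube n k q) hpt) _
    _ = _ := by
      rw [setLIntegral_const, volume_dyadicCube, ← ENNReal.ofReal_mul (by positivity),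
        ← ENNReal.ofReal_mul (by positivity), ← sqrt_inv_pow_mul_pow hl n]
      congr 1
      ring

/-- The coefficient of a Haar function against a region separated from its cube by a hyperplane
`x i = p`, in terms of the distance from the centre of the cube to the hyperplane. -/
theorem exists_lintegral_czIntegral_haarFn_le (n : ℕ) {γ : ℝ} (hγ : 0 < γ) :
    ∃ B : ℝ, 0 < B ∧ ∀ K : (Fin n → ℝ) → (Fin n → ℝ) → ℝ, IsNormalisedKernel n γ K →
      ∀ (k : ℤ) (q : Fin n → ℤ) (η : Fin n → Bool), (η ≠ fun _ => false) →
      ∀ (i : Fin n) (p : ℝ) (A : Set (Fin n → ℝ)), MeasurableSet A →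
      Disjoint A (dyadicCube n k q) → 0 < |cubeCenter n k q i - p| →
      (∀ x ∈ A, ∀ y ∈ dyadicCube n k q, |x i - p| ≤ |x i - y i|) →
      (∀ x ∈ A, |x i - cubeCenter n k q i| = |x i - p| + |cubeCenter n k q i - p|) →
      ENNReal.ofReal ((Real.sqrt ((2:ℝ) ^ (-k)))⁻¹ ^ n) *
          ∫⁻ x in A, ‖czIntegral K (haarFn n k q η) x‖ₑ ≤
        ENNReal.ofReal (B * ((2:ℝ) ^ (-k) / |cubeCenter n k q i - p|) ^ γ) := by
  obtain ⟨B₁, hB₁, htail⟩ := exists_lintegral_dist_tail_le n hγ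
  obtain ⟨B₂, hB₂, htail'⟩ := exists_lintegral_dist_tail_le n (α := 1/2) (by norm_num)
  refine ⟨B₁ + B₂ * 2 ^ (1/2:ℝ) * 2 ^ (n+1), by positivity, ?_⟩
  intro K hK k q η hη i p A hA hdisj hs hxy hxc
  set c := cubeCenter n k q with hc
  set s := |c i - p| with hsdef
  have hl : (0:ℝ) < (2:ℝ) ^ (-k) := by positivity
  set l := (2:ℝ) ^ (-k) with hldef
  have hQ : MeasurableSet (dyadicCube n k q) := measurableSet_dyadicCube n k q
  set E : Set (Fin n → ℝ) := {x | l < dist x c} with hE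
  have hEm : MeasurableSet E := measurableSet_lt measurable_const (by fun_prop)
  have hsdist : ∀ x ∈ A, |x i - p| + s ≤ dist x c := fun x hx => by
    rw [← hxc x hx, ← Real.dist_eq]; exact dist_le_pi_dist x c i
  have hsq : 0 < Real.sqrt l := Real.sqrt_pos.2 hl
  have hfar : ∫⁻ x in A ∩ E, ‖czIntegral K (haarFn n k q η) x‖ₑ ≤
      ENNReal.ofReal (Real.sqrt l ^ n * (B₁ * (l / s) ^ γ)) := by
    calc _ ≤ ∫⁻ x in A ∩ E, ENNReal.ofReal (Real.sqrt l ^ n * l ^ γ) *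
          ENNReal.ofReal (dist x c ^ (-(n:ℝ) - γ)) := by
          refine setLIntegral_mono' (hA.inter hEm) fun x hx => ?_
          rw [← ENNReal.ofReal_mul (by positivity)]
          exact enorm_czIntegral_haarFn_le_smooth hγ hK k q hη hx.2
      _ ≤ ∫⁻ x in {x | s ≤ dist x c}, ENNReal.ofReal (Real.sqrt l ^ n * l ^ γ) *
          ENNReal.ofReal (dist x c ^ (-(n:ℝ) - γ)) :=
          lintegral_mono_set fun x hx =>
            le_trans (le_add_of_nonneg_left (abs_nonneg _)) (hsdist x hx.1)
      _ ≤ ENNReal.ofReal (Real.sqrt l ^ n * l ^ γ) * ENNReal.ofReal (B₁ * s ^ (-γ)) := by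
          rw [lintegral_const_mul' _ _ ENNReal.ofReal_ne_top]
          gcongr
          exact htail s hs c
      _ = _ := by
          rw [← ENNReal.ofReal_mul (by positivity), Real.div_rpow hl.le hs.le,
            Real.rpow_neg hs.le]
          congr 1
          ring
  have hnear : ∫⁻ x in A \ E, ‖czIntegral K (haarFn n k q η) x‖ₑ ≤
      ENNReal.ofReal (Real.sqrt l ^ n * (B₂ * 2 ^ (1/2:ℝ) * 2 ^ (n+1) * (l / s) ^ γ)) := by
    rcases lt_or_ge l s with hls | hls
    · have : A \ E = ∅ := by
        rw [Set.sdiff_eq_empty]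
        intro x hx
        exact hls.trans_le (le_trans (le_add_of_nonneg_left (abs_nonneg _)) (hsdist x hx))
      simp [this]
    have hone : 1 ≤ (l / s) ^ γ := Real.one_le_rpow ((one_le_div hs).2 hls) hγ.le
    have hinner : ∀ x ∈ A \ E, x i ≠ p → ‖czIntegral K (haarFn n k q η) x‖ₑ ≤
        ENNReal.ofReal ((Real.sqrt l)⁻¹ ^ n * (2 * l) ^ (1/2:ℝ) * B₂) *
          ENNReal.ofReal (|x i - p| ^ (-(1/2):ℝ)) := by
      intro x hx hxp
      have ht : 0 < |x i - p| := abs_pos.2 (sub_ne_zero.2 hxp)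
      have hxE : dist x c ≤ l := not_lt.1 hx.2
      refine (enorm_czIntegral_haarFn_le_size hK k q η (hdisj.notMem_of_mem_left hx.1)).trans ?_
      have hyx : ∀ y ∈ dyadicCube n k q, |x i - p| ≤ dist y x := fun y hy => by
        refine (hxy x hx.1 y hy).trans ?_
        rw [← Real.dist_eq, dist_comm]
        exact dist_le_pi_dist y x i
      have hstep : ∫⁻ y in dyadicCube n k q, ENNReal.ofReal (dist x y ^ (-(n:ℝ))) ≤
          ENNReal.ofReal ((2 * l) ^ (1/2:ℝ)) * ENNReal.ofReal (B₂ * |x i - p| ^ (-(1/2):ℝ)) := by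
        calc _ ≤ ∫⁻ y in dyadicCube n k q, ENNReal.ofReal ((2 * l) ^ (1/2:ℝ)) *
              ENNReal.ofReal (dist y x ^ (-(n:ℝ) - 1/2)) := by
              refine setLIntegral_mono' hQ fun y hy => ?_
              rw [← ENNReal.ofReal_mul (by positivity), dist_comm]
              apply ENNReal.ofReal_le_ofReal
              have hpos : 0 < dist y x := ht.trans_le (hyx y hy)
              have hle : dist y x ≤ 2 * l := by
                have h1 := dist_triangle y c x
                have h2 : dist y c ≤ l / 2 := dist_cubeCenter_le hy
                rw [dist_comm c x] at h1
                linarith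
              have : dist y x ^ (-(n:ℝ)) = dist y x ^ (1/2:ℝ) * dist y x ^ (-(n:ℝ) - 1/2) := by
                rw [← Real.rpow_add hpos]; congr 1; ring
              rw [this]
              gcongr
          _ ≤ ∫⁻ y in {y | |x i - p| ≤ dist y x}, ENNReal.ofReal ((2 * l) ^ (1/2:ℝ)) *
              ENNReal.ofReal (dist y x ^ (-(n:ℝ) - 1/2)) := lintegral_mono_set hyx
          _ ≤ _ := by
              rw [lintegral_const_mul' _ _ ENNReal.ofReal_ne_top]
              gcongr
              exact htail' _ ht x
      refine (mul_le_mul_right hstep _).trans ?_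
      rw [← ENNReal.ofReal_mul (by positivity), ← ENNReal.ofReal_mul (by positivity),
        ← ENNReal.ofReal_mul (by positivity)]
      apply ENNReal.ofReal_le_ofReal
      apply le_of_eq
      ring
    have hne : ∀ᵐ x : Fin n → ℝ, x i ≠ p := Measure.ae_eval_ne (fun _ => (volume : Measure ℝ)) i p
    calc _ ≤ ∫⁻ x in A \ E, ENNReal.ofReal ((Real.sqrt l)⁻¹ ^ n * (2 * l) ^ (1/2:ℝ) * B₂) *
          ENNReal.ofReal (|x i - p| ^ (-(1/2):ℝ)) :=
          setLIntegral_mono_ae' (hA.diff hEm) (by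
            filter_upwards [hne] with x hx hxA using hinner x hxA hx)
      _ ≤ ∫⁻ x in {x : Fin n → ℝ | dist x c ≤ l ∧ |x i - p| ≤ l},
          ENNReal.ofReal ((Real.sqrt l)⁻¹ ^ n * (2 * l) ^ (1/2:ℝ) * B₂) *
          ENNReal.ofReal (|x i - p| ^ (-(1/2):ℝ)) := by
          refine lintegral_mono_set fun x hx => ?_
          have h1 : dist x c ≤ l := not_lt.1 hx.2
          exact ⟨h1, by linarith [hsdist x hx.1]⟩
      _ ≤ ENNReal.ofReal ((Real.sqrt l)⁻¹ ^ n * (2 * l) ^ (1/2:ℝ) * B₂) *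
          ENNReal.ofReal (2 ^ (n+1) * l ^ n * l ^ (-(1/2):ℝ)) := by
          rw [lintegral_const_mul' _ _ ENNReal.ofReal_ne_top]
          gcongr
          exact lintegral_rpow_neg_half_le n i c p hl
      _ ≤ _ := by
          rw [← ENNReal.ofReal_mul (by positivity)]
          apply ENNReal.ofReal_le_ofReal
          have h2 : l ^ (1/2:ℝ) * l ^ (-(1/2):ℝ) = 1 := by
            rw [← Real.rpow_add hl]; norm_num
          calc _ = ((Real.sqrt l)⁻¹ ^ n * l ^ n) * (B₂ * 2 ^ (1/2:ℝ) * 2 ^ (n+1)) *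
                (l ^ (1/2:ℝ) * l ^ (-(1/2):ℝ)) := by
                rw [Real.mul_rpow (by norm_num) hl.le]; ring
            _ = Real.sqrt l ^ n * (B₂ * 2 ^ (1/2:ℝ) * 2 ^ (n+1) * 1) := by
                rw [h2, sqrt_inv_pow_mul_pow hl]; ring
            _ ≤ _ := by gcongr
  rw [← lintegral_inter_add_sdiff _ A hEm]
  refine (mul_le_mul_right (add_le_add hfar hnear) _).trans ?_
  rw [← ENNReal.ofReal_add (by positivity) (by positivity), ← ENNReal.ofReal_mul (by positivity)]
  apply ENNReal.ofReal_le_ofReal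
  have h3 : (Real.sqrt l)⁻¹ ^ n * Real.sqrt l ^ n = 1 := by
    rw [← mul_pow, inv_mul_cancel₀ hsq.ne', one_pow]
  calc _ = ((Real.sqrt l)⁻¹ ^ n * Real.sqrt l ^ n) *
        ((B₁ + B₂ * 2 ^ (1/2:ℝ) * 2 ^ (n+1)) * (l / s) ^ γ) := by ring
    _ ≤ _ := by rw [h3, one_mul]

/-- The normalised Haar coefficient is bounded by a lower integral of `T h_K`. -/
theorem ofReal_coefficient_le (n : ℕ) (kJ k : ℤ) (r q : Fin n → ℤ) (η : Fin n → Bool)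
    (K : (Fin n → ℝ) → (Fin n → ℝ) → ℝ) :
    ENNReal.ofReal (sideLen kJ ^ ((n:ℝ)/2) *
        |pairing (haarZero n kJ r) (czIntegral K (haarFn n k q η))| *
        (Real.sqrt ((2:ℝ) ^ (-k)))⁻¹ ^ n) ≤
      ENNReal.ofReal ((Real.sqrt ((2:ℝ) ^ (-k)))⁻¹ ^ n) *
        ∫⁻ x in dyadicCube n kJ r, ‖czIntegral K (haarFn n k q η) x‖ₑ := by
  have hL : (0:ℝ) < (2:ℝ) ^ (-kJ) := by positivity
  have hpow : sideLen kJ ^ ((n:ℝ)/2) = Real.sqrt ((2:ℝ) ^ (-kJ)) ^ n := by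
    rw [sideLen, Real.sqrt_eq_rpow, ← Real.rpow_natCast, ← Real.rpow_mul hL.le]
    congr 1
    ring
  rw [hpow, mul_comm, ENNReal.ofReal_mul (by positivity), ENNReal.ofReal_mul (by positivity),
    ← Real.norm_eq_abs, ofReal_norm]
  refine mul_le_mul_right ((mul_le_mul_right (enorm_pairing_haarZero_le n kJ r _) _).trans ?_) _
  rw [← mul_assoc, ← ENNReal.ofReal_mul (by positivity), ← mul_pow,
    mul_inv_cancel₀ (Real.sqrt_pos.2 hL).ne', one_pow]
  simp

theorem dyadicCube_index_unique {n : ℕ} {k : ℤ} {q r : Fin n → ℤ} {x : Fin n → ℝ}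
    (hq : x ∈ dyadicCube n k q) (hr : x ∈ dyadicCube n k r) : q = r := by
  have hL : (0:ℝ) < (2:ℝ) ^ (-k) := by positivity
  funext i
  obtain ⟨h1, h2⟩ := hq i
  obtain ⟨h3, h4⟩ := hr i
  have h5 : (q i : ℝ) < r i + 1 := lt_of_mul_lt_mul_left (h1.trans_lt h4) hL.le
  have h6 : (r i : ℝ) < q i + 1 := lt_of_mul_lt_mul_left (h3.trans_lt h2) hL.le
  have h7 : q i < r i + 1 := by exact_mod_cast h5
  have h8 : r i < q i + 1 := by exact_mod_cast h6
  omega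

/-- At most one summand of a Haar sum at a fixed scale is nonzero at a given point. -/
theorem exists_lt_of_lt_abs_haarFn_sum {n : ℕ} {ι : Type*} [Fintype ι] {k : ℤ}
    {q : ι → Fin n → ℤ} (hq : Function.Injective q) (η : Fin n → Bool) (P : ι → ℝ) {A lam : ℝ}
    (hA : 0 ≤ A) (hlam : 0 < lam) {x : Fin n → ℝ}
    (h : lam < |A * ∑ a, P a * haarFn n k (q a) η x|) :
    ∃ a, x ∈ dyadicCube n k (q a) ∧ lam < A * |P a| * (Real.sqrt ((2:ℝ) ^ (-k)))⁻¹ ^ n := by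
  have hzero : ∀ a, x ∉ dyadicCube n k (q a) → haarFn n k (q a) η x = 0 := fun a ha => by
    rw [← abs_eq_zero, abs_haarFn, Set.indicator_of_notMem ha]
  by_cases hx : ∃ a, x ∈ dyadicCube n k (q a)
  · obtain ⟨a, ha⟩ := hx
    refine ⟨a, ha, ?_⟩
    rw [Finset.sum_eq_single a
      (fun b _ hb => by
        rw [hzero b fun hb' => hb (hq (dyadicCube_index_unique hb' ha)), mul_zero])
      (fun h => absurd (Finset.mem_univ a) h), abs_mul, abs_mul, abs_haarFn,
      Set.indicator_of_mem ha, abs_of_nonneg hA] at h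
    rwa [mul_assoc]
  · push Not at hx
    rw [Finset.sum_eq_zero fun a _ => by rw [hzero a (hx a), mul_zero]] at h
    simp at h
    linarith

theorem two_zpow_neg_add (k : ℤ) (d : ℕ) :
    (2:ℝ) ^ (-(k + d)) = (2:ℝ) ^ (-k) * (2:ℝ) ^ (-(d:ℝ)) := by
  rw [Real.rpow_neg (by norm_num), Real.rpow_natCast, neg_add, zpow_add₀ (by norm_num)]
  simp

/-- Coordinate bounds for the dyadic subcubes of relative generation `d`, scaled to the parent. -/
theorem subcube_bounds {n : ℕ} (kJ : ℤ) (mJ : Fin n → ℤ) (d : ℕ) (a : Fin n → Fin (2^d))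
    (i : Fin n) :
    ((2:ℝ) ^ (-kJ) * mJ i ≤
      (2:ℝ) ^ (-(kJ + d)) * ((2^d * mJ i + (a i : ℤ) : ℤ) : ℝ)) ∧
    ((2:ℝ) ^ (-(kJ + d)) * (((2^d * mJ i + (a i : ℤ) : ℤ) : ℝ) + 1) ≤
      (2:ℝ) ^ (-kJ) * (mJ i + 1)) := by
  have hl : (0:ℝ) < (2:ℝ) ^ (-(kJ + d)) := by positivity
  have hL : (2:ℝ) ^ (-kJ) = (2:ℝ) ^ (-(kJ + d)) * 2 ^ d := by
    rw [← zpow_natCast, ← zpow_add₀ (by norm_num)]; congr 1; ring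
  have h0 : (0:ℝ) ≤ ((a i : ℕ) : ℝ) := Nat.cast_nonneg _
  have h1 : ((a i : ℕ) : ℝ) + 1 ≤ 2 ^ d := by exact_mod_cast (a i).isLt
  rw [hL, mul_assoc, mul_assoc]
  constructor <;> refine mul_le_mul_of_nonneg_left ?_ hl.le <;> push_cast <;> linarith

theorem injective_subcube_index {n : ℕ} (mJ : Fin n → ℤ) (d : ℕ) :
    Function.Injective fun (a : Fin n → Fin (2^d)) (i : Fin n) => 2^d * mJ i + (a i : ℤ) := by
  intro a b h
  funext i
  have := congrFun h i
  simp only [add_right_inj] at this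
  exact Fin.ext (by exact_mod_cast this)

theorem exists_abs_eq_inorm {n : ℕ} (hn : 0 < n) (m : Fin n → ℤ) :
    ∃ i, |(m i : ℝ)| = inorm m := by
  have : Nonempty (Fin n) := ⟨⟨0, hn⟩⟩
  obtain ⟨i, hi⟩ := Finite.exists_max fun i => |(m i : ℝ)|
  refine ⟨i, le_antisymm (norm_le_pi_norm (fun i => (m i : ℝ)) i) ?_⟩
  exact (pi_norm_le_iff_of_nonneg (abs_nonneg _)).2 hi

/-- The uniform bound of the coefficients when the two cubes are not adjacent. -/
theorem coefficient_le_of_two_le_inorm {n : ℕ} (hn : 0 < n) {γ : ℝ} (hγ : 0 < γ)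
    {K : (Fin n → ℝ) → (Fin n → ℝ) → ℝ} (hK : IsNormalisedKernel n γ K) (kJ : ℤ)
    (mJ : Fin n → ℤ) (d : ℕ) {m : Fin n → ℤ} (hm : 2 ≤ inorm m) {η : Fin n → Bool}
    (hη : η ≠ fun _ => false) (a : Fin n → Fin (2^d)) :
    sideLen kJ ^ ((n:ℝ)/2) *
        |pairing (haarZero n kJ (mJ + m))
          (czIntegral K (haarFn n (kJ + d) (fun i => 2^d * mJ i + (a i : ℤ)) η))| *
        (Real.sqrt ((2:ℝ) ^ (-(kJ + d))))⁻¹ ^ n ≤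
      3 ^ ((n:ℝ) + γ) * ((2:ℝ) ^ (-(d:ℝ))) ^ γ * (1 + inorm m) ^ (-(n:ℝ) - γ) := by
  have hM0 : 0 ≤ inorm m := by linarith
  set q : Fin n → ℤ := fun i => 2^d * mJ i + (a i : ℤ) with hq
  have hl : (0:ℝ) < (2:ℝ) ^ (-(kJ + d)) := by positivity
  have hL : (0:ℝ) < (2:ℝ) ^ (-kJ) := by positivity
  have hlL := two_zpow_neg_add kJ d
  have hd1 : (2:ℝ) ^ (-(d:ℝ)) ≤ 1 := Real.rpow_le_one_of_one_le_of_nonpos (by norm_num) (by simp)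
  have hd0 : (0:ℝ) < (2:ℝ) ^ (-(d:ℝ)) := by positivity
  have hlL1 : (2:ℝ) ^ (-(kJ + d)) ≤ (2:ℝ) ^ (-kJ) := by
    rw [hlL]; exact mul_le_of_le_one_right hL.le hd1
  obtain ⟨i, hi⟩ := exists_abs_eq_inorm hn m
  have hdist : ∀ x ∈ dyadicCube n kJ (mJ + m),
      (2:ℝ) ^ (-kJ) * (inorm m - 1) < dist x (cubeCenter n (kJ + d) q) := by
    intro x hx
    refine lt_of_lt_of_le ?_ (dist_le_pi_dist x _ i)
    obtain ⟨h1, h2⟩ := hx i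
    obtain ⟨h3, h4⟩ := subcube_bounds kJ mJ d a i
    change _ ≤ _ * ((q i : ℤ) : ℝ) at h3
    change _ * (((q i : ℤ) : ℝ) + 1) ≤ _ at h4
    simp only [Pi.add_apply, Int.cast_add] at h1 h2
    rw [Real.dist_eq, ← hi]
    simp only [cubeCenter]
    rcases abs_cases (m i : ℝ) with ⟨h5, _⟩ | ⟨h5, _⟩
    · rw [h5]
      refine lt_of_lt_of_le ?_ (le_abs_self _)
      linarith
    · rw [h5]
      refine lt_of_lt_of_le ?_ (neg_le_abs _)
      linarith
  have hbound : ENNReal.ofReal (sideLen kJ ^ ((n:ℝ)/2) *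
        |pairing (haarZero n kJ (mJ + m)) (czIntegral K (haarFn n (kJ + d) q η))| *
        (Real.sqrt ((2:ℝ) ^ (-(kJ + d))))⁻¹ ^ n) ≤
      ENNReal.ofReal
        (3 ^ ((n:ℝ) + γ) * ((2:ℝ) ^ (-(d:ℝ))) ^ γ * (1 + inorm m) ^ (-(n:ℝ) - γ)) := by
    refine (ofReal_coefficient_le n kJ (kJ + d) (mJ + m) q η K).trans ?_
    set R := (2:ℝ) ^ (-kJ) * (1 + inorm m) / 3 with hR
    have hRpos : 0 < R := by positivity
    have hpt : ∀ x ∈ dyadicCube n kJ (mJ + m), ‖czIntegral K (haarFn n (kJ + d) q η) x‖ₑ ≤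
        ENNReal.ofReal (Real.sqrt ((2:ℝ) ^ (-(kJ + d))) ^ n * ((2:ℝ) ^ (-(kJ + d))) ^ γ *
          R ^ (-(n:ℝ) - γ)) := by
      intro x hx
      have h1 := hdist x hx
      have h2 : (2:ℝ) ^ (-kJ) * 1 ≤ (2:ℝ) ^ (-kJ) * (inorm m - 1) := by gcongr; linarith
      have h3 : R ≤ (2:ℝ) ^ (-kJ) * (inorm m - 1) := by
        rw [hR, mul_div_assoc]; gcongr; linarith
      refine (enorm_czIntegral_haarFn_le_smooth hγ hK _ q hη (by linarith)).trans ?_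
      apply ENNReal.ofReal_le_ofReal
      refine mul_le_mul_of_nonneg_left ?_ (by positivity)
      refine Real.rpow_le_rpow_of_nonpos hRpos (by linarith) ?_
      have : (0:ℝ) ≤ n := n.cast_nonneg
      linarith
    refine (mul_le_mul_right
      (setLIntegral_mono' (measurableSet_dyadicCube n kJ _) hpt) _).trans ?_
    rw [setLIntegral_const, volume_dyadicCube, ← ENNReal.ofReal_mul (by positivity),
      ← ENNReal.ofReal_mul (by positivity)]
    apply ENNReal.ofReal_le_ofReal
    have h3 : (Real.sqrt ((2:ℝ) ^ (-(kJ + d))))⁻¹ ^ n * Real.sqrt ((2:ℝ) ^ (-(kJ + d))) ^ n = 1 := by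
      rw [← mul_pow, inv_mul_cancel₀ (Real.sqrt_pos.2 hl).ne', one_pow]
    have h4 : R ^ (-(n:ℝ) - γ) =
        ((2:ℝ) ^ (-kJ)) ^ (-(n:ℝ) - γ) * (1 + inorm m) ^ (-(n:ℝ) - γ) * 3 ^ ((n:ℝ) + γ) := by
      rw [hR, Real.div_rpow (by positivity) (by norm_num),
        Real.mul_rpow hL.le (by linarith), div_eq_mul_inv, ← Real.rpow_neg (by norm_num)]
      congr 2
      ring
    have h5 : ((2:ℝ) ^ (-kJ)) ^ γ * ((2:ℝ) ^ (-kJ)) ^ (-(n:ℝ) - γ) * ((2:ℝ) ^ (-kJ)) ^ n = 1 := by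
      rw [← Real.rpow_natCast ((2:ℝ) ^ (-kJ)) n, ← Real.rpow_add hL, ← Real.rpow_add hL]
      ring_nf
      exact Real.rpow_zero _
    rw [h4]
    have h6 : ((2:ℝ) ^ (-(kJ + d))) ^ γ = ((2:ℝ) ^ (-kJ)) ^ γ * ((2:ℝ) ^ (-(d:ℝ))) ^ γ := by
      rw [hlL, Real.mul_rpow hL.le hd0.le]
    rw [h6]
    apply le_of_eq
    generalize ((2:ℝ) ^ (-kJ)) ^ γ = u1 at *
    generalize ((2:ℝ) ^ (-kJ)) ^ (-(n:ℝ) - γ) = u2 at *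
    generalize ((2:ℝ) ^ (-kJ)) ^ n = u3 at *
    generalize (Real.sqrt ((2:ℝ) ^ (-(kJ + d))))⁻¹ ^ n = u4 at *
    generalize Real.sqrt ((2:ℝ) ^ (-(kJ + d))) ^ n = u5 at *
    calc _ = (u4 * u5) * (u1 * u2 * u3) *
        (3 ^ ((n:ℝ) + γ) * ((2:ℝ) ^ (-(d:ℝ))) ^ γ * (1 + inorm m) ^ (-(n:ℝ) - γ)) := by ring
      _ = _ := by rw [h3, h5]; ring
  exact (ENNReal.ofReal_le_ofReal_iff (by positivity)).1 hbound

/-- Adjacent cubes are separated by a coordinate hyperplane which bounds the first cube. -/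
theorem exists_separating_hyperplane {n : ℕ} (kJ : ℤ) (mJ : Fin n → ℤ) {m : Fin n → ℤ}
    (hm0 : m ≠ 0) (hm : ∀ i, |m i| ≤ 1) :
    ∃ (i : Fin n) (p : ℝ),
      ((2:ℝ) ^ (-kJ) * (mJ i + 1) ≤ p ∧ ∀ x ∈ dyadicCube n kJ (mJ + m), p ≤ x i) ∨
      (p ≤ (2:ℝ) ^ (-kJ) * mJ i ∧ ∀ x ∈ dyadicCube n kJ (mJ + m), x i ≤ p) := by
  obtain ⟨i, hi⟩ := Function.ne_iff.1 hm0
  simp only [Pi.zero_apply] at hi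
  have h1 := abs_le.1 (hm i)
  have h2 : m i = 1 ∨ m i = -1 := by omega
  rcases h2 with h2 | h2
  · refine ⟨i, (2:ℝ) ^ (-kJ) * (mJ i + 1), Or.inl ⟨le_rfl, fun x hx => ?_⟩⟩
    have := (hx i).1
    simpa [h2] using this
  · refine ⟨i, (2:ℝ) ^ (-kJ) * mJ i, Or.inr ⟨le_rfl, fun x hx => ?_⟩⟩
    have := (hx i).2
    simp only [Pi.add_apply, h2, Int.cast_add, Int.cast_neg, Int.cast_one] at this
    rw [neg_add_cancel_right] at this
    exact this.le

/-- For adjacent cubes the coefficient decays with the distance to the separating hyperplane. -/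
theorem exists_coefficient_le_of_adjacent (n : ℕ) {γ : ℝ} (hγ : 0 < γ) :
    ∃ B : ℝ, 0 < B ∧ ∀ K : (Fin n → ℝ) → (Fin n → ℝ) → ℝ, IsNormalisedKernel n γ K →
      ∀ (kJ : ℤ) (mJ : Fin n → ℤ) (d : ℕ) (m : Fin n → ℤ), m ≠ 0 → (∀ i, |m i| ≤ 1) →
      ∃ (i : Fin n) (p : ℝ), ∀ η : Fin n → Bool, (η ≠ fun _ => false) →
      ∀ a : Fin n → Fin (2^d),
        ∃ s : ℝ, (2:ℝ) ^ (-(kJ + d)) ≤ 2 * s ∧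
          (∀ x ∈ dyadicCube n (kJ + d) (fun i => 2^d * mJ i + (a i : ℤ)), |x i - p| ≤ 2 * s) ∧
          sideLen kJ ^ ((n:ℝ)/2) *
            |pairing (haarZero n kJ (mJ + m))
              (czIntegral K (haarFn n (kJ + d) (fun i => 2^d * mJ i + (a i : ℤ)) η))| *
            (Real.sqrt ((2:ℝ) ^ (-(kJ + d))))⁻¹ ^ n ≤ B * ((2:ℝ) ^ (-(kJ + d)) / s) ^ γ := by
  obtain ⟨B, hB, hmain⟩ := exists_lintegral_czIntegral_haarFn_le n hγ
  refine ⟨B, hB, fun K hK kJ mJ d m hm0 hm => ?_⟩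
  obtain ⟨i, p, hp⟩ := exists_separating_hyperplane kJ mJ hm0 hm
  refine ⟨i, p, fun η hη a => ?_⟩
  set q : Fin n → ℤ := fun i => 2^d * mJ i + (a i : ℤ) with hq
  have hl : (0:ℝ) < (2:ℝ) ^ (-(kJ + d)) := by positivity
  obtain ⟨h3, h4⟩ := subcube_bounds kJ mJ d a i
  change _ ≤ _ * ((q i : ℤ) : ℝ) at h3
  change _ * (((q i : ℤ) : ℝ) + 1) ≤ _ at h4
  have hci : cubeCenter n (kJ + d) q i = (2:ℝ) ^ (-(kJ + d)) * (q i + 1/2) := rfl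
  have hs : (2:ℝ) ^ (-(kJ + d)) ≤ 2 * |cubeCenter n (kJ + d) q i - p| := by
    rw [hci]
    rcases hp with ⟨h5, -⟩ | ⟨h5, -⟩
    · linarith [neg_le_abs ((2:ℝ) ^ (-(kJ + d)) * (q i + 1/2) - p)]
    · linarith [le_abs_self ((2:ℝ) ^ (-(kJ + d)) * (q i + 1/2) - p)]
  have hspos : 0 < |cubeCenter n (kJ + d) q i - p| := by linarith
  refine ⟨|cubeCenter n (kJ + d) q i - p|, hs, fun x hx => ?_, ?_⟩
  · have h5 := (dist_le_pi_dist x _ i).trans (dist_cubeCenter_le hx)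
    rw [Real.dist_eq] at h5
    have h6 := abs_sub_le (x i) (cubeCenter n (kJ + d) q i) p
    linarith
  · have hdisj : Disjoint (dyadicCube n kJ (mJ + m)) (dyadicCube n (kJ + d) q) := by
      rw [Set.disjoint_left]
      intro x hx hx'
      have hxJ : x ∈ dyadicCube n kJ mJ := fun j => by
        obtain ⟨h7, h8⟩ := subcube_bounds kJ mJ d a j
        exact ⟨h7.trans (hx' j).1, (hx' j).2.trans_le h8⟩
      have := dyadicCube_index_unique hx hxJ
      exact hm0 (by simpa using this)
    have h := hmain K hK (kJ + d) q η hη i p (dyadicCube n kJ (mJ + m))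
      (measurableSet_dyadicCube _ _ _) hdisj hspos ?_ ?_
    · exact (ENNReal.ofReal_le_ofReal_iff (by positivity)).1
        ((ofReal_coefficient_le n kJ (kJ + d) (mJ + m) q η K).trans h)
    · intro x hx y hy
      obtain ⟨h5, h6⟩ := hy i
      rcases hp with ⟨h7, h8⟩ | ⟨h7, h8⟩
      · have := h8 x hx
        rw [abs_of_nonneg (by linarith), abs_of_nonneg (by linarith)]
        linarith
      · have := h8 x hx
        rw [abs_of_nonpos (by linarith), abs_of_nonpos (by linarith)]
        linarith
    · intro x hx
      rw [hci]
      rcases hp with ⟨h7, h8⟩ | ⟨h7, h8⟩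
      · have := h8 x hx
        rw [abs_of_nonneg (by linarith), abs_of_nonneg (by linarith), abs_of_nonpos (by linarith)]
        ring
      · have := h8 x hx
        rw [abs_of_nonpos (by linarith), abs_of_nonpos (by linarith), abs_of_nonneg (by linarith)]
        ring

open Classical in
/-- Lemma 6.2: the distributional estimate for the local sums of Haar coefficients.
The cube `J` is indexed by `(kJ, mJ)`, the cubes `K ⊆ J` with `ℓ(K) = 2^{-d} ℓ(J)` by `a`. -/
theorem statement19 (n : ℕ) (hn : 0 < n) (γ : ℝ) (hγ0 : 0 < γ) (hγ1 : γ ≤ 1) :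
    ∃ C : ℝ, 0 < C ∧
      ∀ K : (Fin n → ℝ) → (Fin n → ℝ) → ℝ, IsNormalisedKernel n γ K →
      ∀ (kJ : ℤ) (mJ : Fin n → ℤ) (d : ℕ) (m : Fin n → ℤ), m ≠ 0 →
      ∀ η : Fin n → Bool, η ≠ (fun _ => false) →
      ∀ lam : ℝ, 0 < lam →
        ((¬ (∀ i, |m i| ≤ 1)) →
          volume {x ∈ dyadicCube n kJ mJ |
              lam < |sideLen kJ ^ ((n:ℝ)/2) *
                ∑ a : Fin n → Fin (2^d),
                  pairing (haarZero n kJ (mJ + m))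
                      (czIntegral K (haarFn n (kJ + d) (fun i => 2^d * mJ i + (a i : ℤ)) η)) *
                    haarFn n (kJ + d) (fun i => 2^d * mJ i + (a i : ℤ)) η x|} ≤
            ENNReal.ofReal
                (indR (lam ≤ C * ((2:ℝ) ^ (-(d:ℝ))) ^ γ * (1 + inorm m) ^ (-(n:ℝ) - γ))) *
              volume (dyadicCube n kJ mJ)) ∧
        ((∀ i, |m i| ≤ 1) →
          volume {x ∈ dyadicCube n kJ mJ |
              lam < |sideLen kJ ^ ((n:ℝ)/2) *
                ∑ a : Fin n → Fin (2^d),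
                  pairing (haarZero n kJ (mJ + m))
                      (czIntegral K (haarFn n (kJ + d) (fun i => 2^d * mJ i + (a i : ℤ)) η)) *
                    haarFn n (kJ + d) (fun i => 2^d * mJ i + (a i : ℤ)) η x|} ≤
            ENNReal.ofReal
                (C * min (lam ^ (-(1:ℝ)/γ) * (2:ℝ) ^ (-(d:ℝ))) 1 * indR (lam ≤ C)) *
              volume (dyadicCube n kJ mJ)) := by
  obtain ⟨B, hB, hadj⟩ := exists_coefficient_le_of_adjacent n hγ0
  refine ⟨3 ^ ((n:ℝ) + γ) + 2 * B + 4 * B ^ (1/γ), by positivity, ?_⟩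
  set C := 3 ^ ((n:ℝ) + γ) + 2 * B + 4 * B ^ (1/γ) with hC
  have hCpos : 0 < C := by positivity
  have hC1 : 3 ^ ((n:ℝ) + γ) ≤ C := by
    have : 0 < B ^ (1/γ) := by positivity
    linarith
  have hC2 : 2 * B ≤ C := by
    have : 0 < B ^ (1/γ) := by positivity
    have : (0:ℝ) < 3 ^ ((n:ℝ) + γ) := by positivity
    linarith
  have hC3 : 4 * B ^ (1/γ) ≤ C := by
    have : (0:ℝ) < 3 ^ ((n:ℝ) + γ) := by positivity
    linarith
  intro K hK kJ mJ d m hm0 η hη lam hlam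
  have hA : (0:ℝ) ≤ sideLen kJ ^ ((n:ℝ)/2) :=
    Real.rpow_nonneg (by unfold sideLen; positivity) _
  have hsum := fun x => exists_lt_of_lt_abs_haarFn_sum (k := kJ + d) (x := x)
    (injective_subcube_index mJ d) η
    (fun a => pairing (haarZero n kJ (mJ + m))
      (czIntegral K (haarFn n (kJ + d) (fun i => 2^d * mJ i + (a i : ℤ)) η))) hA hlam
  constructor
  · intro hm
    have hM : 2 ≤ inorm m := by
      push Not at hm
      obtain ⟨i, hi⟩ := hm
      have h1 : (2:ℝ) ≤ |(m i : ℝ)| := by exact_mod_cast hi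
      exact h1.trans (norm_le_pi_norm (fun i => (m i : ℝ)) i)
    by_cases hle : lam ≤ C * ((2:ℝ) ^ (-(d:ℝ))) ^ γ * (1 + inorm m) ^ (-(n:ℝ) - γ)
    · rw [indR, if_pos hle, ENNReal.ofReal_one, one_mul]
      exact measure_mono fun x hx => hx.1
    · refine le_of_eq_of_le ?_ zero_le
      rw [← measure_empty (μ := (volume : Measure (Fin n → ℝ)))]
      congr 1
      refine Set.eq_empty_of_forall_notMem fun x hx => hle ?_
      obtain ⟨a, -, ha⟩ := hsum x hx.2
      refine ha.le.trans ((coefficient_le_of_two_le_inorm hn hγ0 hK kJ mJ d hM hη a).trans ?_)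
      gcongr
  · intro hm
    obtain ⟨i, p, hip⟩ := hadj K hK kJ mJ d m hm0 hm
    have hl : (0:ℝ) < (2:ℝ) ^ (-(kJ + d)) := by positivity
    by_cases hle : lam ≤ C
    · rw [indR, if_pos hle, mul_one, volume_dyadicCube, ← ENNReal.ofReal_mul (by positivity)]
      have hL : (0:ℝ) < (2:ℝ) ^ (-kJ) := by positivity
      rcases le_total (lam ^ (-(1:ℝ)/γ) * (2:ℝ) ^ (-(d:ℝ))) 1 with h1 | h1
      · rw [min_eq_left h1]
        have hsub : ∀ x ∈ dyadicCube n kJ mJ,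
            (lam < |sideLen kJ ^ ((n:ℝ)/2) *
              ∑ a : Fin n → Fin (2^d),
                pairing (haarZero n kJ (mJ + m))
                    (czIntegral K (haarFn n (kJ + d) (fun i => 2^d * mJ i + (a i : ℤ)) η)) *
                  haarFn n (kJ + d) (fun i => 2^d * mJ i + (a i : ℤ)) η x|) →
            |x i - p| ≤ 2 * (B ^ (1/γ) * lam ^ (-(1:ℝ)/γ) * (2:ℝ) ^ (-(kJ + d))) := by
          intro x _ hx
          obtain ⟨a, hxa, ha⟩ := hsum x hx
          obtain ⟨s, hs, hxs, hN⟩ := hip η hη a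
          have hs0 : 0 < s := by linarith
          refine (hxs x hxa).trans ?_
          gcongr
          have h2 : lam < B * ((2:ℝ) ^ (-(kJ + d)) / s) ^ γ := ha.trans_le hN
          have h3 : lam ^ (1/γ) ≤ B ^ (1/γ) * ((2:ℝ) ^ (-(kJ + d)) / s) := by
            have h4 := Real.rpow_le_rpow hlam.le h2.le (by positivity : 0 ≤ 1/γ)
            rwa [Real.mul_rpow hB.le (by positivity), ← Real.rpow_mul (by positivity),
              mul_one_div_cancel hγ0.ne', Real.rpow_one] at h4
          rw [neg_div, Real.rpow_neg hlam.le]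
          have h5 : 0 < lam ^ (1/γ) := by positivity
          rw [← mul_div_assoc, le_div_iff₀ hs0] at h3
          rw [mul_right_comm, ← div_eq_mul_inv, le_div_iff₀ h5]
          linarith
        refine (measure_mono (fun x hx => (⟨hx.1, hsub x hx.1 hx.2⟩ :
          x ∈ {x ∈ dyadicCube n kJ mJ | |x i - p| ≤
            2 * (B ^ (1/γ) * lam ^ (-(1:ℝ)/γ) * (2:ℝ) ^ (-(kJ + d)))}))).trans
          ((volume_dyadicCube_inter_strip_le n kJ mJ i p (by positivity)).trans ?_)
        apply ENNReal.ofReal_le_ofReal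
        rw [two_zpow_neg_add]
        calc _ = 4 * B ^ (1/γ) * (lam ^ (-(1:ℝ)/γ) * (2:ℝ) ^ (-(d:ℝ))) * ((2:ℝ) ^ (-kJ)) ^ n := by
              field_simp
              ring
          _ ≤ _ := by gcongr
      · rw [min_eq_right h1, mul_one]
        refine (measure_mono (fun x hx => hx.1)).trans (le_of_eq_of_le
          (volume_dyadicCube n kJ mJ) (ENNReal.ofReal_le_ofReal ?_))
        refine le_mul_of_one_le_left (by positivity) (le_trans ?_ hC1)
        exact Real.one_le_rpow (by norm_num) (by positivity)
    · refine le_of_eq_of_le ?_ zero_le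
      rw [← measure_empty (μ := (volume : Measure (Fin n → ℝ)))]
      congr 1
      refine Set.eq_empty_of_forall_notMem fun x hx => hle ?_
      obtain ⟨a, -, ha⟩ := hsum x hx.2
      obtain ⟨s, hs, -, hN⟩ := hip η hη a
      have hs0 : 0 < s := by linarith
      refine (ha.le.trans hN).trans (le_trans ?_ hC2)
      have h2 : ((2:ℝ) ^ (-(kJ + d)) / s) ^ γ ≤ 2 := by
        calc _ ≤ (2:ℝ) ^ γ := by
              refine Real.rpow_le_rpow (by positivity) ?_ hγ0.le
              rwa [div_le_iff₀ hs0]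
          _ ≤ 2 ^ (1:ℝ) := Real.rpow_le_rpow_of_exponent_le (by norm_num) hγ1
          _ = 2 := Real.rpow_one 2
      nlinarith

end
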